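/- Under the standing hypotheses on q, λ, Φ_q, Φ_{q+λ}, W, f, K_c, K_p listed in the context, the function Γ̄(a) := sup_{b > a} Γ(a, b) is continuous and strictly increasing on (−∞, ā₂). -/

import Mathlib

open MeasureTheory Filter Set Real

noncomputable section

/-- Tilted inventory-cost derivative integrand against the scale function:
`ρ_a(b) = ∫_a^b g(y) W(b - y) dy`. -/
def rho (W g : ℝ → ℝ) (a b : ℝ) : ℝ :=
  ∫ y in a..b, g y * W (b - y)

/-- `Γ(a, b)` of the paper (display (Gamma)). -/
def Gam (lam Phiq Kp Kc : ℝ) (W g : ℝ → ℝ) (a b : ℝ) : ℝ :=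
  (∫ y in Set.Ioi (0:ℝ), Real.exp (-Phiq * y) * g (y + a)) +
    lam * (∫ y in (0:ℝ)..(b - a), Real.exp (-Phiq * y) * rho W g a (y + a)) +
    lam / Phiq * Real.exp (-Phiq * (b - a)) * (Kp - Kc)

/-- `Γ₁(a) = Γ(a, a+)`. -/
def Gam1 (lam Phiq Kp Kc : ℝ) (g : ℝ → ℝ) (a : ℝ) : ℝ :=
  (∫ y in Set.Ioi (0:ℝ), Real.exp (-Phiq * y) * g (y + a)) + lam / Phiq * (Kp - Kc)

/-- `Γ₂(a) = lim_{b→∞} Γ(a,b)/Θ(b-a)`. -/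
def Gam2 (Phiql : ℝ) (g : ℝ → ℝ) (a : ℝ) : ℝ :=
  ∫ y in Set.Ioi (0:ℝ), Real.exp (-Phiql * y) * g (y + a)

/-- `Θ(x) = Θ^{(q+λ)}(x, Φ(q))`. -/
def Theta (lam Phiq : ℝ) (W : ℝ → ℝ) (x : ℝ) : ℝ :=
  1 + lam * (∫ y in (0:ℝ)..x, Real.exp (-Phiq * y) * W y)

/-- `γ(a,b) = -ρ_a(b) + K_p - K_c`. -/
def gam (Kp Kc : ℝ) (W g : ℝ → ℝ) (a b : ℝ) : ℝ :=
  -(rho W g a b) + Kp - Kc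

/-- `Z(x) = Z^{(q+λ)}(x) = 1 + (q+λ)∫₀^{x ∨ 0} W(y) dy`. -/
def Zfun (q lam : ℝ) (W : ℝ → ℝ) (x : ℝ) : ℝ :=
  1 + (q + lam) * (∫ y in (0:ℝ)..(max x 0), W y)

/-- Second scale function `Ẑ(x) = Z^{(q+λ)}(x, Φ(q))`. -/
def Zhat (lam Phiq : ℝ) (W : ℝ → ℝ) (x : ℝ) : ℝ :=
  Real.exp (Phiq * x) *
    (1 + lam * (∫ z in (0:ℝ)..(max x 0), Real.exp (-Phiq * z) * W z))

/-- The supremum over `x > 0` of a family whose increments in `a` are positive and nondecreasing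
in `x` is continuous and strictly increasing in `a`. -/
theorem continuousOn_strictMonoOn_sSup_of_monotone_increments {F : ℝ → ℝ → ℝ} {c : ℝ}
    (hinc : ∀ a a', a < a' → ∀ x X, 0 ≤ x → x ≤ X → F a' x - F a x ≤ F a' X - F a X)
    (hpos : ∀ a a', a < c → a < a' → F a 0 < F a' 0)
    (hbdd : ∀ a < c, BddAbove (F a '' Ioi 0))
    (hlim : ∀ a < c, Tendsto (F a) atTop atBot)
    (hcont : ∀ X, 0 < X → Continuous fun a => F a X) :
    ContinuousOn (fun a => sSup (F a '' Ioi 0)) (Iio c) ∧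
      StrictMonoOn (fun a => sSup (F a '' Ioi 0)) (Iio c) := by
  have hne : ∀ a, (F a '' Ioi 0).Nonempty := fun a => ⟨F a 1, 1, by simp, rfl⟩
  have hle : ∀ a < c, ∀ x, 0 < x → F a x ≤ sSup (F a '' Ioi 0) := fun a ha x hx =>
    le_csSup (hbdd a ha) ⟨x, hx, rfl⟩
  have hmono : ∀ a a', a < c → a ≤ a' → ∀ x, 0 ≤ x → F a x ≤ F a' x := by
    intro a a' hc h x hx
    rcases h.eq_or_lt with rfl | h
    · rfl
    · linarith [hinc a a' h 0 x le_rfl hx, hpos a a' hc h]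
  have hstrict : StrictMonoOn (fun a => sSup (F a '' Ioi 0)) (Iio c) := by
    intro a ha a' ha' h
    have : sSup (F a '' Ioi 0) ≤ sSup (F a' '' Ioi 0) - (F a' 0 - F a 0) := by
      refine csSup_le (hne a) ?_
      rintro _ ⟨x, hx, rfl⟩
      have hx : 0 < x := hx
      linarith [hinc a a' h 0 x le_rfl hx.le, hle a' ha' x hx]
    have := hpos a a' ha h
    dsimp only
    linarith
  refine ⟨fun a ha => ContinuousAt.continuousWithinAt ?_, hstrict⟩
  have ha : a < c := ha
  obtain ⟨a₁, h₁, h₁c⟩ := exists_between ha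
  have h₀ : a - 1 < a := by linarith
  obtain ⟨X, hX⟩ := eventually_atTop.1 ((hlim a₁ h₁c).eventually_le_atBot (F (a - 1) 1))
  set Y := max X 1
  have hYpos : 0 < Y := lt_of_lt_of_le one_pos (le_max_right _ _)
  have key : ∀ b b', a - 1 ≤ b → b < b' → b' ≤ a₁ →
      sSup (F b' '' Ioi 0) ≤ sSup (F b '' Ioi 0) + (F b' Y - F b Y) := by
    intro b b' hb hbb hb'
    have hbc : b < c := by linarith
    refine csSup_le (hne b') ?_
    rintro _ ⟨x, hx, rfl⟩
    have hx : 0 < x := hx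
    rcases le_total x Y with hxY | hxY
    · linarith [hinc b b' hbb x Y hx.le hxY, hle b hbc x hx]
    · have e1 := hmono b' a₁ (by linarith) hb' x hx.le
      have e2 := hX x ((le_max_left _ _).trans hxY)
      have e3 := hmono (a - 1) b (by linarith) hb 1 zero_le_one
      have e4 := hle b hbc 1 one_pos
      have e5 := hmono b b' hbc hbb.le Y hYpos.le
      linarith
  rw [ContinuousAt, tendsto_iff_dist_tendsto_zero]
  have hF : Tendsto (fun b => dist (F b Y) (F a Y)) (nhds a) (nhds 0) :=
    tendsto_iff_dist_tendsto_zero.1 ((hcont Y hYpos).tendsto a)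
  refine squeeze_zero' (Eventually.of_forall fun _ => dist_nonneg) ?_ hF
  filter_upwards [Ioo_mem_nhds h₀ h₁] with b hb
  rw [Real.dist_eq, Real.dist_eq]
  rcases lt_trichotomy b a with h | rfl | h
  · have e1 := key b a hb.1.le h h₁.le
    have e2 := hstrict (mem_Iio.2 (h.trans ha)) ha h
    dsimp only at e2
    rw [abs_of_neg (by linarith), abs_of_neg (by linarith)]
    linarith
  · simp
  · have e1 := key a b h₀.le h hb.2.le
    have e2 := hstrict ha (mem_Iio.2 (hb.2.trans h₁c)) h
    dsimp only at e2
    rw [abs_of_pos (by linarith), abs_of_pos (by linarith)]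
    linarith

theorem Monotone.abs_le_add_abs_of_mem_Icc {h : ℝ → ℝ} (hh : Monotone h) {a x b : ℝ}
    (hx : x ∈ Icc a b) : |h x| ≤ |h a| + |h b| := by
  have h1 := hh hx.1
  have h2 := hh hx.2
  rw [abs_le]
  constructor
  · linarith [neg_abs_le (h a), abs_nonneg (h b)]
  · linarith [le_abs_self (h b), abs_nonneg (h a)]

/-- The right derivative of a convex function is monotone. -/
theorem ConvexOn.monotone_of_hasDerivWithinAt_Ici {f f' : ℝ → ℝ} (hf : ConvexOn ℝ univ f)
    (hf' : ∀ x, HasDerivWithinAt f (f' x) (Ici x) x) : Monotone f' := by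
  have h := hf.monotoneOn_rightDeriv
  have e : (fun x => derivWithin f (Ioi x) x) = f' := funext fun x =>
    ((hf' x).mono Ioi_subset_Ici_self).derivWithin (uniqueDiffWithinAt_Ioi x)
  rw [e, interior_univ, monotoneOn_univ] at h
  exact h

/-- The right derivative of a convex function of at most polynomial growth is subexponential at
infinity, so all its one-sided Laplace transforms converge. -/
theorem ConvexOn.integrableOn_exp_neg_mul_rightDeriv {f f' : ℝ → ℝ} (hf : ConvexOn ℝ univ f)
    (hf' : ∀ x, HasDerivWithinAt f (f' x) (Ici x) x) {C M : ℝ} {N : ℕ}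
    (hgrowth : ∀ x : ℝ, M < |x| → |f x| ≤ C * |x| ^ N) {θ : ℝ} (hθ : 0 < θ) (a : ℝ) :
    IntegrableOn (fun y => exp (-θ * y) * f' (y + a)) (Ioi 0) := by
  have hmono := hf.monotone_of_hasDerivWithinAt_Ici hf'
  have hup : ∀ x, f' x ≤ f (x + 1) - f x := by
    intro x
    have := hf.le_slope_of_hasDerivWithinAt_Ioi (mem_univ x) (mem_univ (x + 1)) (by linarith)
      ((hf' x).mono Ioi_subset_Ici_self)
    simpa [slope_def_field] using this
  have hbig : (fun y => f' (y + a)) =O[atTop] fun y => exp (θ / 2 * y) := by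
    have hpow : ∀ s : ℝ, (fun y : ℝ => f (y + s)) =O[atTop] fun y => exp (θ / 2 * y) := by
      intro s
      have h1 : (fun y : ℝ => f (y + s)) =O[atTop] fun y => (y + s) ^ N := by
        refine Asymptotics.IsBigO.of_bound C ?_
        filter_upwards [eventually_gt_atTop (|M| - s)] with y hy
        have : M < |y + s| := by
          have := le_abs_self (y + s); have := le_abs_self M; linarith
        simpa using hgrowth _ this
      have h2 : (fun y : ℝ => (y + s) ^ N) =o[atTop] fun y => exp (θ / 2 * (y + s)) :=
        (isLittleO_pow_exp_pos_mul_atTop N (half_pos hθ)).comp_tendsto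
          (tendsto_atTop_add_const_right _ s tendsto_id)
      refine (h1.trans h2.isBigO).trans ?_
      simp_rw [mul_add, exp_add, mul_comm _ (exp (θ / 2 * s))]
      exact Asymptotics.isBigO_const_mul_self _ _ _
    have hc : (fun _ : ℝ => f' a) =O[atTop] fun y => exp (θ / 2 * y) := by
      refine Asymptotics.IsBigO.of_bound |f' a| ?_
      filter_upwards [eventually_ge_atTop 0] with y hy
      rw [Real.norm_eq_abs, Real.norm_eq_abs, abs_of_pos (exp_pos _)]
      exact le_mul_of_one_le_right (abs_nonneg _) (one_le_exp (by positivity))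
    have hs := ((hpow (a + 1)).sub (hpow a)).norm_left.add hc.norm_left
    refine Asymptotics.IsBigO.trans ?_ hs
    refine Asymptotics.IsBigO.of_bound 1 ?_
    filter_upwards [eventually_ge_atTop 0] with y hy
    have h1 := hup (y + a)
    have h2 : f' a ≤ f' (y + a) := hmono (by linarith)
    rw [add_assoc] at h1
    rw [one_mul, Real.norm_eq_abs, Real.norm_eq_abs, Real.norm_eq_abs, Real.norm_eq_abs]
    refine le_trans ?_ (le_abs_self _)
    rw [abs_le]
    have := neg_abs_le (f' a)
    have := abs_nonneg (f' a)
    have := le_abs_self (f (y + (a + 1)) - f (y + a))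
    have := abs_nonneg (f (y + (a + 1)) - f (y + a))
    constructor <;> linarith
  have hloc : LocallyIntegrableOn (fun y => exp (-θ * y) * f' (y + a)) (Ici 0) := by
    have hshift : Monotone fun y => f' (y + a) := fun x y h => hmono (by linarith)
    exact (hshift.locallyIntegrable.locallyIntegrableOn _).continuousOn_mul
      (by fun_prop) isClosed_Ici.isLocallyClosed
  refine (hloc.integrableOn_of_isBigO_atTop (g := fun y => exp (-(θ / 2) * y)) ?_
    ⟨Ioi 0, Ioi_mem_atTop 0, exp_neg_integrableOn_Ioi 0 (half_pos hθ)⟩).mono_set Ioi_subset_Ici_self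
  refine ((Asymptotics.isBigO_refl (fun y : ℝ => exp (-θ * y)) atTop).mul hbig).congr_right fun y => ?_
  rw [← exp_add]
  ring_nf

theorem Gam2_monotone {θ : ℝ} {g : ℝ → ℝ} (hg : Monotone g)
    (hint : ∀ a, IntegrableOn (fun y => exp (-θ * y) * g (y + a)) (Ioi 0)) :
    Monotone (Gam2 θ g) := fun a a' h =>
  integral_mono (hint a) (hint a') fun y =>
    mul_le_mul_of_nonneg_left (hg (by linarith)) (exp_pos _).le

theorem Gam2_continuous {θ : ℝ} {g : ℝ → ℝ} (hg : Monotone g)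
    (hint : ∀ a, IntegrableOn (fun y => exp (-θ * y) * g (y + a)) (Ioi 0)) :
    Continuous (Gam2 θ g) := by
  refine continuous_iff_continuousAt.2 fun a => ?_
  refine continuousAt_of_dominated (bound := fun y =>
    ‖exp (-θ * y) * g (y + (a - 1))‖ + ‖exp (-θ * y) * g (y + (a + 1))‖)
    (Eventually.of_forall fun b => (hint b).aestronglyMeasurable) ?_
    ((hint _).norm.add (hint _).norm) ?_
  · filter_upwards [Icc_mem_nhds (by linarith : a - 1 < a) (by linarith : a < a + 1)] with b hb
    refine Eventually.of_forall fun y => ?_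
    have := hg.abs_le_add_abs_of_mem_Icc (a := y + (a - 1)) (x := y + b) (b := y + (a + 1))
      ⟨by linarith [hb.1], by linarith [hb.2]⟩
    simp only [norm_mul, Real.norm_eq_abs, ← mul_add]
    exact mul_le_mul_of_nonneg_left this (abs_nonneg _)
  · have hc : {y : ℝ | ¬ ContinuousAt g (y + a)}.Countable :=
      hg.countable_not_continuousAt.preimage (add_left_injective a)
    filter_upwards [ae_restrict_of_ae (hc.ae_notMem volume)] with y hy
    have hy : ContinuousAt g (y + a) := not_not.1 hy
    exact continuousAt_const.mul (hy.comp (f := fun b => y + b) (by fun_prop))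

theorem bddBelow_setOf_Gam2_nonneg {θ : ℝ} (hθ : 0 < θ) {g : ℝ → ℝ} (hg : Monotone g)
    (hint : ∀ a, IntegrableOn (fun y => exp (-θ * y) * g (y + a)) (Ioi 0)) {B : ℝ} (hB : g B < 0) :
    BddBelow {a | 0 ≤ Gam2 θ g a} := by
  have hexp : IntegrableOn (fun y => exp (-θ * y) * g B) (Ioi 0) :=
    (exp_neg_integrableOn_Ioi 0 hθ).mul_const _
  have hlim : Tendsto (fun a => ∫ y in Ioi (0 : ℝ), exp (-θ * y) * max (g (y + a)) (g B)) atBot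
      (nhds (∫ y in Ioi (0 : ℝ), exp (-θ * y) * g B)) := by
    refine tendsto_integral_filter_of_dominated_convergence (fun y =>
      ‖exp (-θ * y) * g (y + B)‖ + ‖exp (-θ * y) * g B‖)
      (Eventually.of_forall fun a => ?_) ?_ ((hint B).norm.add hexp.norm) ?_
    · have : Measurable fun y => g (y + a) := hg.measurable.comp (measurable_add_const a)
      exact ((by fun_prop : Measurable fun y : ℝ => exp (-θ * y)).mul
        (this.max measurable_const)).aestronglyMeasurable
    · filter_upwards [eventually_le_atBot B] with a ha
      filter_upwards [ae_restrict_mem measurableSet_Ioi] with y hy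
      have hy : 0 < y := hy
      have h1 := (monotone_id : Monotone (id : ℝ → ℝ)).abs_le_add_abs_of_mem_Icc
        (a := g B) (x := max (g (y + a)) (g B)) (b := g (y + B))
        ⟨le_max_right _ _, max_le (hg (by linarith)) (hg (by linarith))⟩
      simp only [norm_mul, Real.norm_eq_abs, ← mul_add]
      exact mul_le_mul_of_nonneg_left (by simpa [add_comm] using h1) (abs_nonneg _)
    · refine Eventually.of_forall fun y => ?_
      refine tendsto_const_nhds.congr' ?_
      filter_upwards [eventually_le_atBot (B - y)] with a ha
      rw [max_eq_right (hg (by linarith))]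
  have hneg : ∫ y in Ioi (0 : ℝ), exp (-θ * y) * g B < 0 := by
    rw [integral_mul_const, integral_exp_mul_Ioi (by linarith)]
    refine mul_neg_of_pos_of_neg ?_ hB
    simp [hθ]
  obtain ⟨m, hm⟩ := eventually_atBot.1 (hlim.eventually_lt_const hneg)
  refine ⟨m, fun a ha => ?_⟩
  by_contra! h
  refine absurd (lt_of_le_of_lt ?_ (hm a h.le)) (not_lt.2 ha)
  refine integral_mono (hint a) ?_ fun y =>
    mul_le_mul_of_nonneg_left (le_max_left _ _) (exp_pos _).le
  exact ((hint a).sup hexp).congr (Eventually.of_forall fun y =>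
    (mul_max_of_nonneg _ _ (exp_pos _).le).symm)

/-- Equality of two Laplace transforms of shifts of `g` makes `g` almost periodic, hence constant,
beyond `a`. -/
theorem Gam2_lt_Gam2 {θ η : ℝ} {g : ℝ → ℝ} (hg : Monotone g)
    (hint : ∀ a, IntegrableOn (fun y => exp (-θ * y) * g (y + a)) (Ioi 0)) {z₀ : ℝ} (hz₀ : 0 ≤ g z₀)
    {a a' : ℝ} (ha : Gam2 η g a < 0) (h : a < a') : Gam2 θ g a < Gam2 θ g a' := by
  by_contra! hle
  have heq : ∀ᵐ y : ℝ, 0 < y → g (y + a) = g (y + a') := by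
    have h0 : ∫ y in Ioi (0 : ℝ), (exp (-θ * y) * g (y + a') - exp (-θ * y) * g (y + a)) = 0 := by
      rw [integral_sub (hint a') (hint a), sub_eq_zero]
      exact le_antisymm hle (Gam2_monotone hg hint h.le)
    rw [integral_eq_zero_iff_of_nonneg (fun y => sub_nonneg.2 (mul_le_mul_of_nonneg_left
      (hg (by linarith)) (exp_pos _).le)) ((hint a').sub (hint a))] at h0
    filter_upwards [(ae_restrict_iff' measurableSet_Ioi).1 h0] with y hy hy0
    have := hy hy0
    simp only [Pi.zero_apply, ← mul_sub, mul_eq_zero, (exp_pos _).ne', false_or] at this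
    linarith
  have hd := Measure.dense_of_ae heq
  have hstep : ∀ n : ℕ, ∀ z, a < z → z₀ - n * (a' - a) < z → 0 ≤ g z := by
    intro n
    induction n with
    | zero => intro z _ hz; exact hz₀.trans (hg (by simpa using hz.le))
    | succ n ih =>
      intro z haz hz
      push_cast at hz
      obtain ⟨w, hw, hw1, hw2⟩ := hd.exists_between
        (show max 0 (z₀ - (n + 1) * (a' - a) - a) < z - a from max_lt (by linarith) (by linarith))
      have hw0 : 0 < w := (le_max_left _ _).trans_lt hw1
      have hw3 := (le_max_right _ _).trans_lt hw1
      have : 0 ≤ g (w + a') := ih _ (by linarith) (by linarith)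
      rw [← hw hw0] at this
      exact this.trans (hg (by linarith))
  refine absurd (setIntegral_nonneg measurableSet_Ioi fun y hy => ?_) (not_le.2 ha)
  have hy : 0 < y := hy
  obtain ⟨n, hn⟩ := exists_nat_gt ((z₀ - a) / (a' - a))
  rw [div_lt_iff₀ (by linarith)] at hn
  exact mul_nonneg (exp_pos _).le (hstep n _ (by linarith) (by linarith))

theorem Monotone.nonneg_of_eq_zero_of_neg {W : ℝ → ℝ} (hW : Monotone W) (hW0 : ∀ x < 0, W x = 0)
    (x : ℝ) : 0 ≤ W x :=
  (hW0 _ (min_lt_of_right_lt (by norm_num : (-1 : ℝ) < 0))).symm.le.trans (hW (min_le_left x (-1)))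

theorem integrableOn_shift_mul_comp_sub {W g : ℝ → ℝ} (hg : Monotone g) (hW : Monotone W)
    (a y X : ℝ) : IntegrableOn (fun u => g (u + a) * W (y - u)) (Ioc 0 X) := by
  have hgm : Measurable fun u => g (u + a) := hg.measurable.comp (measurable_add_const a)
  have hWm : Measurable fun u => W (y - u) := hW.measurable.comp (measurable_const.sub measurable_id)
  refine Measure.integrableOn_of_bounded (by simp) (hgm.mul hWm).aestronglyMeasurable
    (M := (|g (0 + a)| + |g (X + a)|) * (|W (y - X)| + |W (y - 0)|)) ?_
  filter_upwards [ae_restrict_mem measurableSet_Ioc] with u hu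
  rw [norm_mul, Real.norm_eq_abs, Real.norm_eq_abs]
  exact mul_le_mul (hg.abs_le_add_abs_of_mem_Icc ⟨by linarith [hu.1], by linarith [hu.2]⟩)
    (hW.abs_le_add_abs_of_mem_Icc ⟨by linarith [hu.2], by linarith [hu.1]⟩) (abs_nonneg _)
    (by positivity)

theorem rho_add_eq_setIntegral {W g : ℝ → ℝ} (hW0 : ∀ x < 0, W x = 0) (a : ℝ) {y : ℝ} (hy : 0 ≤ y)
    {s : Set ℝ} (hs : MeasurableSet s) (hys : Ioc 0 y ⊆ s) (hs0 : s ⊆ Ioi 0) :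
    rho W g a (y + a) = ∫ u in s, g (u + a) * W (y - u) := by
  have h := intervalIntegral.integral_comp_add_right (a := 0) (b := y)
    (fun z => g z * W (y + a - z)) a
  rw [zero_add] at h
  rw [rho, ← h, intervalIntegral.integral_of_le hy]
  simp only [add_sub_add_right_eq_sub]
  refine (setIntegral_eq_of_subset_of_forall_sdiff_eq_zero hs hys fun u hu => ?_).symm
  have : y < u := not_le.1 fun h => hu.2 ⟨hs0 hu.1, h⟩
  rw [hW0 _ (by linarith), mul_zero]

theorem rho_add_le_rho_add {W g : ℝ → ℝ} (hg : Monotone g) (hW : Monotone W)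
    (hW0 : ∀ x < 0, W x = 0) {a a' y : ℝ} (hy : 0 ≤ y) (h : a ≤ a') :
    rho W g a (y + a) ≤ rho W g a' (y + a') := by
  have hWnn := hW.nonneg_of_eq_zero_of_neg hW0
  rw [rho_add_eq_setIntegral hW0 a hy measurableSet_Ioc Subset.rfl Ioc_subset_Ioi_self,
    rho_add_eq_setIntegral hW0 a' hy measurableSet_Ioc Subset.rfl Ioc_subset_Ioi_self]
  exact integral_mono (integrableOn_shift_mul_comp_sub hg hW a y y)
    (integrableOn_shift_mul_comp_sub hg hW a' y y) fun u =>
    mul_le_mul_of_nonneg_right (hg (by linarith)) (hWnn _)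

theorem rho_add_sub_rho_add_le {W g : ℝ → ℝ} (hg : Monotone g) (hW : Monotone W)
    (hW0 : ∀ x < 0, W x = 0) {a a' y X : ℝ} (hy : 0 ≤ y) (hyX : y ≤ X) (h : a ≤ a') :
    rho W g a' (y + a') - rho W g a (y + a) ≤
      W X * ((∫ u in 0..X, g (u + a')) - ∫ u in 0..X, g (u + a)) := by
  have hs : Ioc 0 y ⊆ Ioc 0 X := Ioc_subset_Ioc_right hyX
  have hi : ∀ b, IntervalIntegrable (fun u => g (u + b)) volume 0 X := fun b =>
    Monotone.intervalIntegrable fun u v huv => hg (by linarith)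
  rw [rho_add_eq_setIntegral hW0 a hy measurableSet_Ioc hs Ioc_subset_Ioi_self,
    rho_add_eq_setIntegral hW0 a' hy measurableSet_Ioc hs Ioc_subset_Ioi_self,
    ← integral_sub (integrableOn_shift_mul_comp_sub hg hW a' y X)
      (integrableOn_shift_mul_comp_sub hg hW a y X),
    ← intervalIntegral.integral_sub (hi a') (hi a), ← intervalIntegral.integral_const_mul,
    intervalIntegral.integral_of_le (hy.trans hyX)]
  refine setIntegral_mono_on ((integrableOn_shift_mul_comp_sub hg hW a' y X).sub
    (integrableOn_shift_mul_comp_sub hg hW a y X)) (((hi a').sub (hi a)).const_mul _).1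
    measurableSet_Ioc fun u hu => ?_
  have h1 : g (u + a) ≤ g (u + a') := hg (by linarith)
  have h2 : W (y - u) ≤ W X := hW (by linarith [hu.1])
  nlinarith

theorem intervalIntegrable_exp_mul_rho_add {W g : ℝ → ℝ} (hg : Monotone g) (hW : Monotone W)
    (hW0 : ∀ x < 0, W x = 0) (p a : ℝ) {X : ℝ} (hX : 0 ≤ X) :
    IntervalIntegrable (fun y => exp (-p * y) * rho W g a (y + a)) volume 0 X := by
  rw [intervalIntegrable_iff_integrableOn_Ioc_of_le hX]
  have hmeas : StronglyMeasurable fun y => ∫ u in Ioc 0 X, g (u + a) * W (y - u) := by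
    refine StronglyMeasurable.integral_prod_right (f := fun y u => g (u + a) * W (y - u))
      (Measurable.stronglyMeasurable ?_)
    exact (hg.measurable.comp (measurable_snd.add_const a)).mul
      (hW.measurable.comp (measurable_fst.sub measurable_snd))
  have heq : ∀ y ∈ Ioc 0 X, ∫ u in Ioc 0 X, g (u + a) * W (y - u) = rho W g a (y + a) := fun y hy =>
    (rho_add_eq_setIntegral hW0 a hy.1.le measurableSet_Ioc (Ioc_subset_Ioc_right hy.2)
      Ioc_subset_Ioi_self).symm
  have hint : IntegrableOn (fun y => ∫ u in Ioc 0 X, g (u + a) * W (y - u)) (Ioc 0 X) := by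
    refine Measure.integrableOn_of_bounded (by simp) hmeas.aestronglyMeasurable
      (M := (|g (0 + a)| + |g (X + a)|) * (|W (0 - X)| + |W X|) * volume.real (Ioc 0 X)) ?_
    filter_upwards [ae_restrict_mem measurableSet_Ioc] with y hy
    refine norm_setIntegral_le_of_norm_le_const (by simp) fun u hu => ?_
    rw [norm_mul, Real.norm_eq_abs, Real.norm_eq_abs]
    exact mul_le_mul (hg.abs_le_add_abs_of_mem_Icc ⟨by linarith [hu.1], by linarith [hu.2]⟩)
      (hW.abs_le_add_abs_of_mem_Icc ⟨by linarith [hu.2, hy.1], by linarith [hu.1, hy.2]⟩)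
      (abs_nonneg _) (by positivity)
  have hrho : IntegrableOn (fun y => rho W g a (y + a)) (Ioc 0 X) :=
    hint.congr_fun heq measurableSet_Ioc
  exact hrho.continuousOn_mul_of_subset (K := Icc 0 X) (by fun_prop) isCompact_Icc
    measurableSet_Ioc Ioc_subset_Icc_self

theorem tendsto_rho_add_div {W g : ℝ → ℝ} {θ : ℝ} (hg : Monotone g) (hW : Monotone W)
    (hW0 : ∀ x < 0, W x = 0)
    (hratio_mono : ∀ u : ℝ, 0 < u → MonotoneOn (fun x => W (x - u) / W x) (Ioi u))
    (hratio_lim : ∀ u : ℝ, 0 < u →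
      Tendsto (fun x => W (x - u) / W x) atTop (nhds (exp (-θ * u))))
    (hint : ∀ a, IntegrableOn (fun y => exp (-θ * y) * g (y + a)) (Ioi 0)) (a : ℝ) :
    Tendsto (fun x => rho W g a (x + a) / W x) atTop (nhds (Gam2 θ g a)) := by
  have hWnn := hW.nonneg_of_eq_zero_of_neg hW0
  have hlim : Tendsto (fun x => ∫ u in Ioi (0 : ℝ), W (x - u) / W x * g (u + a)) atTop
      (nhds (Gam2 θ g a)) := by
    refine tendsto_integral_filter_of_dominated_convergence
      (fun u => ‖exp (-θ * u) * g (u + a)‖) (Eventually.of_forall fun x => ?_)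
      (Eventually.of_forall fun x => ?_) (hint a).norm ?_
    · exact Measurable.aestronglyMeasurable
        (((hW.measurable.comp (measurable_const.sub measurable_id)).div_const _).mul
          (hg.measurable.comp (measurable_add_const a)))
    · filter_upwards [ae_restrict_mem measurableSet_Ioi,
        ae_restrict_of_ae ((countable_singleton x).ae_notMem volume)] with u hu hux
      rw [norm_mul, norm_mul]
      refine mul_le_mul_of_nonneg_right ?_ (norm_nonneg _)
      rw [Real.norm_of_nonneg (exp_pos _).le, Real.norm_of_nonneg (div_nonneg (hWnn _) (hWnn _))]
      rcases lt_or_gt_of_ne hux with h | h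
      · refine ge_of_tendsto (hratio_lim u hu) ?_
        filter_upwards [eventually_ge_atTop x] with b hb
        exact hratio_mono u hu h (mem_Ioi.2 (h.trans_le hb)) hb
      · rw [hW0 _ (by linarith), zero_div]
        exact (exp_pos _).le
    · filter_upwards [ae_restrict_mem measurableSet_Ioi] with u hu
      exact (hratio_lim u hu).mul_const _
  refine hlim.congr' ?_
  filter_upwards [eventually_ge_atTop 0] with x hx
  rw [rho_add_eq_setIntegral hW0 a hx measurableSet_Ioi Ioc_subset_Ioi_self Subset.rfl,
    ← integral_div]
  congr 1 with u
  ring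

/-- If `ρ_a(a + x) / W(x)` has a negative limit, the tilted integral of `ρ_a` diverges to `-∞`. -/
theorem tendsto_integral_exp_mul_rho_add_atBot {W g : ℝ → ℝ} {p θ L a : ℝ} (hpθ : p < θ)
    (hg : Monotone g) (hW : Monotone W) (hW0 : ∀ x < 0, W x = 0) (hL : 0 < L)
    (hWlim : Tendsto (fun x => exp (-θ * x) * W x) atTop (nhds L)) {G : ℝ} (hG : G < 0)
    (hlim : Tendsto (fun x => rho W g a (x + a) / W x) atTop (nhds G)) :
    Tendsto (fun x => ∫ y in 0..x, exp (-p * y) * rho W g a (y + a)) atTop atBot := by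
  have hev : ∀ᶠ x in atTop, exp (-p * x) * rho W g a (x + a) ≤ G / 2 * (L / 2) := by
    filter_upwards [hlim.eventually_lt_const (by linarith : G < G / 2),
      hWlim.eventually_const_lt (half_lt_self hL), eventually_ge_atTop 0] with x h1 h2 hx
    have hWx : 0 < W x := pos_of_mul_pos_right ((half_pos hL).trans h2) (exp_pos _).le
    rw [div_lt_iff₀ hWx] at h1
    have h3 : L / 2 ≤ exp (-p * x) * W x := by
      refine h2.le.trans (mul_le_mul_of_nonneg_right (exp_le_exp.2 ?_) hWx.le)
      nlinarith
    calc exp (-p * x) * rho W g a (x + a) ≤ exp (-p * x) * (G / 2 * W x) :=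
          mul_le_mul_of_nonneg_left h1.le (exp_pos _).le
      _ = G / 2 * (exp (-p * x) * W x) := by ring
      _ ≤ G / 2 * (L / 2) := mul_le_mul_of_nonpos_left h3 (by linarith)
  obtain ⟨X, hX⟩ := eventually_atTop.1 (hev.and (eventually_ge_atTop 0))
  have hX0 : 0 ≤ X := (hX X le_rfl).2
  have hκ : G / 2 * (L / 2) < 0 := mul_neg_of_neg_of_pos (by linarith) (by linarith)
  refine tendsto_atBot_mono' atTop (f₁ := fun x =>
    (∫ y in 0..X, exp (-p * y) * rho W g a (y + a)) + G / 2 * (L / 2) * (x - X)) ?_ ?_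
  · filter_upwards [eventually_ge_atTop X] with x hx
    have h0X := intervalIntegrable_exp_mul_rho_add hg hW hW0 p a hX0
    have hXx := h0X.symm.trans (intervalIntegrable_exp_mul_rho_add hg hW hW0 p a (hX0.trans hx))
    rw [← intervalIntegral.integral_add_adjacent_intervals h0X hXx]
    have := intervalIntegral.integral_mono_on hx hXx intervalIntegrable_const
      fun y hy => (hX y hy.1).1
    rw [intervalIntegral.integral_const, smul_eq_mul] at this
    linarith
  · exact tendsto_atBot_add_const_left _ _
      ((tendsto_atTop_add_const_right _ (-X) tendsto_id).const_mul_atTop_of_neg hκ)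

theorem continuous_integral_exp_mul_rho_add {W g : ℝ → ℝ} {p : ℝ} (hp : 0 ≤ p) (hg : Monotone g)
    (hW : Monotone W) (hW0 : ∀ x < 0, W x = 0) {X : ℝ} (hX : 0 ≤ X) :
    Continuous fun a => ∫ y in 0..X, exp (-p * y) * rho W g a (y + a) := by
  have hG : Continuous fun a => ∫ u in 0..X, g (u + a) := by
    have hi : ∀ s t, IntervalIntegrable g volume s t := fun s t => hg.intervalIntegrable
    have e : (fun a => ∫ u in 0..X, g (u + a)) =
        fun a => (∫ u in 0..(X + a), g u) - ∫ u in 0..a, g u := by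
      ext a
      rw [intervalIntegral.integral_comp_add_right, zero_add,
        intervalIntegral.integral_interval_sub_left (hi _ _) (hi _ _)]
    rw [e]
    have hc := intervalIntegral.continuous_primitive hi 0
    exact (hc.comp (continuous_const.add continuous_id)).sub hc
  have hi := fun a => intervalIntegrable_exp_mul_rho_add hg hW hW0 p a hX
  have key : ∀ a a', a ≤ a' →
      |(∫ y in 0..X, exp (-p * y) * rho W g a' (y + a')) -
        ∫ y in 0..X, exp (-p * y) * rho W g a (y + a)| ≤
      |W X * ((∫ u in 0..X, g (u + a')) - ∫ u in 0..X, g (u + a))| * |X - 0| := by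
    intro a a' h
    rw [← intervalIntegral.integral_sub (hi a') (hi a), ← Real.norm_eq_abs]
    refine intervalIntegral.norm_integral_le_of_norm_le_const fun y hy => ?_
    rw [uIoc_of_le hX] at hy
    have h1 := sub_nonneg.2 (rho_add_le_rho_add hg hW hW0 hy.1.le h)
    have h2 := rho_add_sub_rho_add_le hg hW hW0 hy.1.le hy.2 h
    rw [← mul_sub, norm_mul, Real.norm_of_nonneg (exp_pos _).le, Real.norm_of_nonneg h1]
    have h3 : exp (-p * y) ≤ 1 := exp_le_one_iff.2 (by nlinarith [hy.1])
    exact (mul_le_of_le_one_left h1 h3).trans (h2.trans (le_abs_self _))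
  refine continuous_iff_continuousAt.2 fun a => tendsto_iff_dist_tendsto_zero.2 ?_
  refine squeeze_zero (fun _ => dist_nonneg) (g := fun b =>
    |W X * ((∫ u in 0..X, g (u + b)) - ∫ u in 0..X, g (u + a))| * |X - 0|) (fun b => ?_) ?_
  · rw [Real.dist_eq]
    rcases le_total a b with h | h
    · exact key a b h
    · rw [abs_sub_comm, ← neg_sub (∫ u in 0..X, g (u + a)), mul_neg, abs_neg]
      exact key b a h
  · have : Continuous fun b =>
        |W X * ((∫ u in 0..X, g (u + b)) - ∫ u in 0..X, g (u + a))| * |X - 0| := by fun_prop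
    simpa using this.tendsto a

/-- Proposition 5.5 (monotonicity and continuity of the running maximum of Γ) of the paper. -/
theorem GammaBar_continuous_strictMono
    (q lam Phiq Phiql : ℝ) (hq : 0 < q) (hlam : 0 < lam)
    (hPhiq : 0 < Phiq) (hPhi : Phiq < Phiql)
    (W : ℝ → ℝ)
    (hW0 : ∀ x < (0:ℝ), W x = 0)
    (hWnn : ∀ x ≥ (0:ℝ), 0 ≤ W x)
    (hWcont : ContinuousOn W (Set.Ici 0))
    (hWmono : StrictMonoOn W (Set.Ici 0))
    (hWC1 : ContDiffOn ℝ 1 W (Set.Ioi 0))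
    (hWratio_mono : ∀ a y : ℝ, a < y →
      MonotoneOn (fun b => W (b - y) / W (b - a)) (Set.Ioi y))
    (hWratio_lim : ∀ a y : ℝ, a < y →
      Filter.Tendsto (fun b => W (b - y) / W (b - a)) Filter.atTop
        (nhds (Real.exp (-Phiql * (y - a)))))
    (hWasymp : ∃ L : ℝ, 0 < L ∧
      Filter.Tendsto (fun x => Real.exp (-Phiql * x) * W x) Filter.atTop (nhds L))
    (f f' : ℝ → ℝ)
    (hf_conv : ConvexOn ℝ Set.univ f)
    (hf_deriv : ∀ x : ℝ, HasDerivWithinAt f (f' x) (Set.Ici x) x)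
    (hf_pw : ∃ E : Set ℝ, E.Countable ∧ ∀ x ∉ E, ContinuousAt f' x)
    (hf_growth : ∃ C M : ℝ, ∃ N : ℕ, 0 < C ∧ 0 < M ∧
      ∀ x : ℝ, M < |x| → |f x| ≤ C * |x| ^ N)
    (Kc Kp : ℝ) (hK : Kp < Kc)
    (g : ℝ → ℝ) (hg : ∀ x : ℝ, g x = f' x + q * Kc + lam * (Kc - Kp))
    (habar_ne : {a : ℝ | 0 ≤ g a}.Nonempty)
    (habar_bdd : BddBelow {a : ℝ | 0 ≤ g a})
    (habb_ne : {a : ℝ | 0 < f' a + q * Kp}.Nonempty)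
    (habb_bdd : BddBelow {a : ℝ | 0 < f' a + q * Kp})
    (a2 : ℝ) (ha2 : a2 = sInf {a : ℝ | 0 ≤ Gam2 Phiql g a}) :
    ContinuousOn
      (fun a => sSup ((fun b => Gam lam Phiq Kp Kc W g a b) '' Set.Ioi a))
      (Set.Iio a2) ∧
    StrictMonoOn
      (fun a => sSup ((fun b => Gam lam Phiq Kp Kc W g a b) '' Set.Ioi a))
      (Set.Iio a2) := by
  have hWm : Monotone W := by
    intro x y hxy
    rcases lt_or_ge x 0 with hx | hx
    · rw [hW0 x hx]
      rcases lt_or_ge y 0 with hy | hy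
      · exact (hW0 y hy).ge
      · exact hWnn y hy
    · exact hWmono.monotoneOn hx (hx.trans hxy) hxy
  have hf'm := hf_conv.monotone_of_hasDerivWithinAt_Ici hf_deriv
  have hgm : Monotone g := fun x y h => by
    rw [hg, hg]
    linarith [hf'm h]
  obtain ⟨C, M, N, -, -, hgrowth⟩ := hf_growth
  have hint : ∀ θ, 0 < θ → ∀ a, IntegrableOn (fun y => exp (-θ * y) * g (y + a)) (Ioi 0) := by
    intro θ hθ a
    refine ((hf_conv.integrableOn_exp_neg_mul_rightDeriv hf_deriv hgrowth hθ a).add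
      ((exp_neg_integrableOn_Ioi 0 hθ).mul_const (q * Kc + lam * (Kc - Kp)))).congr
      (Eventually.of_forall fun y => ?_)
    simp only [Pi.add_apply, hg]
    ring
  have hPl : 0 < Phiql := hPhiq.trans hPhi
  obtain ⟨z₀, hz₀⟩ := habar_ne
  obtain ⟨m, hm⟩ := habar_bdd
  have hB : g (m - 1) < 0 := by
    by_contra! h
    linarith [hm h]
  have hneg : ∀ a < a2, Gam2 Phiql g a < 0 := by
    intro a ha
    rw [ha2] at ha
    exact not_le.1 fun h =>
      notMem_of_lt_csInf ha (bddBelow_setOf_Gam2_nonneg hPl hgm (hint _ hPl) hB) h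
  have hratio_mono : ∀ u : ℝ, 0 < u → MonotoneOn (fun x => W (x - u) / W x) (Ioi u) := by
    simpa only [sub_zero] using hWratio_mono 0
  have hratio_lim : ∀ u : ℝ, 0 < u →
      Tendsto (fun x => W (x - u) / W x) atTop (nhds (exp (-Phiql * u))) := by
    simpa only [sub_zero] using hWratio_lim 0
  obtain ⟨L, hL, hWlim⟩ := hWasymp
  set J : ℝ → ℝ → ℝ := fun a x => ∫ y in (0 : ℝ)..x, exp (-Phiq * y) * rho W g a (y + a) with hJ
  set F : ℝ → ℝ → ℝ := fun a x =>
    Gam2 Phiq g a + lam * J a x + lam / Phiq * exp (-Phiq * x) * (Kp - Kc) with hF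
  have hJi := fun a X (hX : 0 ≤ X) => intervalIntegrable_exp_mul_rho_add hgm hWm hW0 Phiq a hX
  have himage : (fun a => sSup ((fun b => Gam lam Phiq Kp Kc W g a b) '' Ioi a)) =
      fun a => sSup (F a '' Ioi 0) := by
    ext a
    congr 1
    have : Ioi a = (fun x => x + a) '' Ioi 0 := by simp
    rw [this, image_image]
    simp only [Gam, add_sub_cancel_right, hF, hJ, Gam2]
  have hlim : ∀ a < a2, Tendsto (F a) atTop atBot := by
    intro a ha
    have hJlim : Tendsto (J a) atTop atBot :=
      tendsto_integral_exp_mul_rho_add_atBot hPhi hgm hWm hW0 hL hWlim (hneg a ha)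
        (tendsto_rho_add_div hgm hWm hW0 hratio_mono hratio_lim (hint _ hPl) a)
    refine tendsto_atBot_mono (fun x => ?_) (tendsto_atBot_add_const_left atTop (Gam2 Phiq g a)
      (hJlim.const_mul_atBot hlam))
    have : lam / Phiq * exp (-Phiq * x) * (Kp - Kc) ≤ 0 :=
      mul_nonpos_of_nonneg_of_nonpos (by positivity) (by linarith)
    simp only [hF]
    linarith
  rw [himage]
  refine continuousOn_strictMonoOn_sSup_of_monotone_increments ?_ ?_ ?_ hlim ?_
  · intro a a' h x X hx hxX
    have hsplit : ∀ b, J b X - J b x = ∫ y in x..X, exp (-Phiq * y) * rho W g b (y + b) := fun b =>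
      intervalIntegral.integral_interval_sub_left (hJi b X (hx.trans hxX)) (hJi b x hx)
    have hi := fun b => (hJi b x hx).symm.trans (hJi b X (hx.trans hxX))
    have := intervalIntegral.integral_mono_on hxX (hi a) (hi a') fun y hy =>
      mul_le_mul_of_nonneg_left (rho_add_le_rho_add hgm hWm hW0 (hx.trans hy.1) h.le)
        (exp_pos _).le
    rw [← hsplit, ← hsplit] at this
    have := mul_le_mul_of_nonneg_left this hlam.le
    simp only [hF]
    linarith
  · intro a a' ha h
    have := Gam2_lt_Gam2 hgm (hint _ hPhiq) hz₀ (hneg a ha) h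
    simpa [hF, hJ] using this
  · intro a ha
    obtain ⟨X, hX⟩ := eventually_atTop.1 ((hlim a ha).eventually_le_atBot 0)
    have hX0 : (0 : ℝ) ≤ max X 0 := le_max_right _ _
    have hJc : ContinuousOn (J a) (Icc 0 (max X 0)) := by
      have := intervalIntegral.continuousOn_primitive_interval' (hJi a _ hX0) left_mem_uIcc
      rwa [uIcc_of_le hX0] at this
    have hFc : ContinuousOn (F a) (Icc 0 (max X 0)) := by
      simp only [hF]
      fun_prop
    obtain ⟨B, hB⟩ := isCompact_Icc.bddAbove_image hFc
    refine ⟨max B 0, ?_⟩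
    rintro _ ⟨x, hx, rfl⟩
    have hx : 0 < x := hx
    rcases le_total x (max X 0) with h | h
    · exact le_max_of_le_left (hB ⟨x, ⟨hx.le, h⟩, rfl⟩)
    · exact le_max_of_le_right (hX x ((le_max_left _ _).trans h))
  · intro X hX
    exact ((Gam2_continuous hgm (hint _ hPhiq)).add (continuous_const.mul
      (continuous_integral_exp_mul_rho_add hPhiq.le hgm hWm hW0 hX.le))).add continuous_const
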